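/- Let K be a field and a, b, c pairwise coprime positive integers. Suppose f is a negative curve in [𝔭_K(a,b,c)^{(r0)}]_{d0} with d0/r0 < √(abc). Then for any positive integer r and any nonnegative integer d with d/r < d0/r0 (i.e., d·r0 < d0·r), one has [𝔭_K(a,b,c)^{(r)}]_d = 0. -/

import Mathlib

open MvPolynomial

noncomputable section

/-- The weight function assigning degrees `a, b, c` to the variables `x, y, z`. -/
def wt (a b c : ℕ) : Fin 3 → ℕ := ![a, b, c]

/-- The `K`-algebra map `K[x,y,z] → K[T]`, `x ↦ T^a`, `y ↦ T^b`, `z ↦ T^c`. -/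
def toPoly (K : Type*) [CommRing K] (a b c : ℕ) :
    MvPolynomial (Fin 3) K →ₐ[K] Polynomial K :=
  aeval ![Polynomial.X ^ a, Polynomial.X ^ b, Polynomial.X ^ c]

/-- The space monomial prime `𝔭_K(a,b,c)`. -/
def pIdeal (K : Type*) [CommRing K] (a b c : ℕ) : Ideal (MvPolynomial (Fin 3) K) :=
  RingHom.ker (toPoly K a b c)

instance pIdeal_isPrime (K : Type*) [Field K] (a b c : ℕ) : (pIdeal K a b c).IsPrime :=
  RingHom.ker_isPrime _

/-- The `n`-th symbolic power `Q^{(n)} = Q^n A_Q ∩ A` of a prime ideal. -/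
def symbPow {A : Type*} [CommRing A] (Q : Ideal A) [Q.IsPrime] (n : ℕ) : Ideal A :=
  Ideal.comap (algebraMap A (Localization.AtPrime Q))
    (Ideal.map (algebraMap A (Localization.AtPrime Q)) (Q ^ n))

/-- The symbolic Rees algebra `A[Qt, Q^{(2)}t^2, …] ⊆ A[t]`. -/
def symbolicRees {A : Type*} [CommRing A] (Q : Ideal A) [Q.IsPrime] :
    Subalgebra A (Polynomial A) :=
  Algebra.adjoin A
    (⋃ n : ℕ, (fun p => Polynomial.C p * Polynomial.X ^ n) '' ((symbPow Q n : Ideal A) : Set A))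

/-- The degree-`d` homogeneous component `[J]_d` of an ideal `J ⊆ K[x,y,z]`,
as a `K`-subspace. -/
def gpiece (K : Type*) [CommRing K] (a b c : ℕ) (J : Ideal (MvPolynomial (Fin 3) K))
    (d : ℕ) : Submodule K (MvPolynomial (Fin 3) K) :=
  (Submodule.restrictScalars K J) ⊓ (weightedHomogeneousSubmodule K (wt a b c) d)

end

theorem MvPolynomial.IsWeightedHomogeneous.exists_of_mul {K σ : Type*} [Field K] {w : σ → ℕ}
    {f g : MvPolynomial σ K} {e n : ℕ} (hf : f.IsWeightedHomogeneous w e)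
    (hfg : (f * g).IsWeightedHomogeneous w n) (hf0 : f ≠ 0) (hg0 : g ≠ 0) :
    ∃ j, e + j = n ∧ g.IsWeightedHomogeneous w j := by
  classical
  have key (j : ℕ) : weightedHomogeneousComponent w (e + j) (f * g)
      = f * weightedHomogeneousComponent w j g := by
    let _ := weightedGradedAlgebra K w
    have h := DirectSum.coe_decompose_mul_add_of_left_mem (weightedHomogeneousSubmodule K w)
      (j := j) (b := g) (show f ∈ weightedHomogeneousSubmodule K w e from hf)
    have h1 := weightedDecomposition.decompose'_apply K (w := w) (f * g) (e + j)
    have h2 := weightedDecomposition.decompose'_apply K (w := w) g j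
    rw [← h1, ← h2]
    exact h
  have hz (j : ℕ) (hj : e + j ≠ n) : weightedHomogeneousComponent w j g = 0 := by
    have h := key j
    rw [hfg.weightedHomogeneousComponent_ne (e + j) hj] at h
    exact (mul_eq_zero.mp h.symm).resolve_left hf0
  by_cases hen : e ≤ n
  · refine ⟨n - e, by omega, ?_⟩
    have hg : weightedHomogeneousComponent w (n - e) g = g := by
      conv_rhs => rw [← sum_weightedHomogeneousComponent w g]
      rw [finsum_eq_single _ (n - e)]
      exact fun j hj => hz j (by omega)
    rw [← hg]
    exact weightedHomogeneousComponent_isWeightedHomogeneous _ _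
  · exfalso
    apply hg0
    rw [← sum_weightedHomogeneousComponent w g]
    rw [finsum_eq_zero_of_forall_eq_zero]
    exact fun j => hz j (by omega)

/-- The maximal ideal of the point `(1, 1, 1)`. -/
noncomputable def onesIdeal (K : Type*) [CommRing K] : Ideal (MvPolynomial (Fin 3) K) :=
  Ideal.span (Set.range fun i => X i - 1)

theorem derivation_mem_pow {R A : Type*} [CommRing R] [CommRing A] [Algebra R A]
    (D : Derivation R A A) (I : Ideal A) (n : ℕ) {x : A} (hx : x ∈ I ^ (n + 1)) :
    D x ∈ I ^ n := by
  induction n generalizing x with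
  | zero => simp
  | succ n ih =>
    rw [pow_succ] at hx
    induction hx using Submodule.mul_induction_on' with
    | mem_mul_mem y hy z hz =>
      rw [Derivation.leibniz, smul_eq_mul, smul_eq_mul]
      refine add_mem (Ideal.mul_mem_right _ _ hy) ?_
      rw [pow_succ, mul_comm z]
      exact Ideal.mul_mem_mul (ih hy) hz
    | add y _ z _ hy hz => simpa using add_mem hy hz

theorem map_mem_onesIdeal_pow {K L : Type*} [CommRing K] [CommRing L] (φ : K →+* L) {n : ℕ}
    {f : MvPolynomial (Fin 3) K} (hf : f ∈ onesIdeal K ^ n) :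
    MvPolynomial.map φ f ∈ onesIdeal L ^ n := by
  have h : (onesIdeal K).map (MvPolynomial.map φ) ≤ onesIdeal L := by
    rw [onesIdeal, Ideal.map_span, Ideal.span_le]
    rintro _ ⟨_, ⟨i, rfl⟩, rfl⟩
    exact Ideal.subset_span ⟨i, by simp⟩
  have h2 := Ideal.mem_map_of_mem (MvPolynomial.map φ) hf
  rw [Ideal.map_pow] at h2
  exact Ideal.pow_right_mono h n h2

theorem mem_idealOfVars_iff_constantCoeff {σ R : Type*} [CommRing R] {f : MvPolynomial σ R} :
    f ∈ idealOfVars σ R ↔ constantCoeff f = 0 := by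
  rw [← pow_one (idealOfVars σ R), mem_pow_idealOfVars_iff']
  refine ⟨fun h => h 0 (by simp), fun h x hx => ?_⟩
  have : x = 0 := by
    rw [← Finsupp.degree_eq_zero_iff]; omega
  rw [this]
  exact h

theorem mem_onesIdeal_pow_of_aeval {K : Type*} [CommRing K] {f : MvPolynomial (Fin 3) K} {n : ℕ}
    (hf : aeval (fun i => X i + 1 : Fin 3 → MvPolynomial (Fin 3) K) f
      ∈ idealOfVars (Fin 3) K ^ n) : f ∈ onesIdeal K ^ n := by
  let ψ : MvPolynomial (Fin 3) K →ₐ[K] MvPolynomial (Fin 3) K := aeval fun i => X i - 1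
  have h : (idealOfVars (Fin 3) K).map ψ ≤ onesIdeal K := by
    rw [idealOfVars, Ideal.map_span, Ideal.span_le]
    rintro _ ⟨_, ⟨i, rfl⟩, rfl⟩
    exact Ideal.subset_span ⟨i, by simp [ψ]⟩
  have h2 := Ideal.mem_map_of_mem ψ hf
  rw [Ideal.map_pow] at h2
  have h3 : ψ (aeval (fun i => X i + 1 : Fin 3 → MvPolynomial (Fin 3) K) f) = f := by
    rw [← AlgHom.comp_apply]
    have : ψ.comp (aeval (fun i => X i + 1 : Fin 3 → MvPolynomial (Fin 3) K))
        = AlgHom.id K _ := by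
      ext i : 1
      simp [ψ]
    rw [this]; rfl
  rw [h3] at h2
  exact Ideal.pow_right_mono h n h2

theorem MvPolynomial.IsWeightedHomogeneous.eval₂_mul {σ K R : Type*} [Fintype σ]
    [CommRing K] [CommRing R] {w : σ → ℕ} {f : MvPolynomial σ K} {d : ℕ}
    (hf : f.IsWeightedHomogeneous w d) (φ : K →+* R) (t : R) (x : σ → R) :
    eval₂ φ (fun i => t ^ w i * x i) f = t ^ d * eval₂ φ x f := by
  rw [eval₂_eq', eval₂_eq', Finset.mul_sum]
  refine Finset.sum_congr rfl fun m hm => ?_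
  have hm : Finsupp.weight w m = d := hf (mem_support_iff.mp hm)
  rw [Finsupp.weight_apply, Finsupp.sum_fintype _ _ (by simp)] at hm
  simp only [mul_pow, Finset.prod_mul_distrib, ← pow_mul, Finset.prod_pow_eq_pow_sum]
  rw [← hm]
  simp only [smul_eq_mul, mul_comm (w _)]
  ring

theorem mem_onesIdeal_pow_of_mem_symbPow {K : Type*} [Field K] {a b c n d : ℕ}
    {f : MvPolynomial (Fin 3) K} (hf : f ∈ symbPow (pIdeal K a b c) n)
    (hfh : f.IsWeightedHomogeneous (wt a b c) d) : f ∈ onesIdeal K ^ n := by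
  rw [symbPow, Ideal.mem_comap,
    IsLocalization.algebraMap_mem_map_algebraMap_iff (pIdeal K a b c).primeCompl] at hf
  obtain ⟨s, hs, hsf⟩ := hf
  let L := FractionRing (Polynomial K)
  let t : L := algebraMap (Polynomial K) L Polynomial.X
  let ι : K →+* L := (algebraMap (Polynomial K) L).comp Polynomial.C
  let φ : MvPolynomial (Fin 3) K →+* MvPolynomial (Fin 3) L :=
    eval₂Hom (C.comp ι) fun i => C t ^ wt a b c i * (X i + 1)
  have hφ : (constantCoeff (σ := Fin 3) (R := L)).comp φ
      = (algebraMap (Polynomial K) L).comp (toPoly K a b c).toRingHom := by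
    ext i
    · simp [φ, ι, Polynomial.algebraMap_eq]
    · fin_cases i <;> simp [φ, wt, toPoly, t]
  have hφ' (g) : constantCoeff (φ g) = algebraMap (Polynomial K) L (toPoly K a b c g) :=
    congrArg (fun ψ : MvPolynomial (Fin 3) K →+* L => ψ g) hφ
  have hJ : idealOfVars (Fin 3) L = RingHom.ker (constantCoeff (σ := Fin 3) (R := L)) := by
    ext g
    rw [mem_idealOfVars_iff_constantCoeff, RingHom.mem_ker]
  have hmax : (idealOfVars (Fin 3) L).IsMaximal := by
    rw [hJ]
    exact RingHom.ker_isMaximal_of_surjective _ fun x => ⟨C x, by simp⟩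
  have hle : (pIdeal K a b c).map φ ≤ idealOfVars (Fin 3) L := by
    rw [Ideal.map_le_iff_le_comap]
    intro g hg
    rw [Ideal.mem_comap, mem_idealOfVars_iff_constantCoeff, hφ']
    rw [pIdeal, RingHom.mem_ker] at hg
    rw [hg, map_zero]
  have h1 : φ s * φ f ∈ idealOfVars (Fin 3) L ^ n := by
    have := Ideal.mem_map_of_mem φ hsf
    rw [Ideal.map_pow, map_mul] at this
    exact Ideal.pow_right_mono hle n this
  have h2 : φ f ∈ idealOfVars (Fin 3) L ^ n := by
    refine (Ideal.IsMaximal.mul_mem_pow _ h1).resolve_left fun h => hs ?_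
    rw [mem_idealOfVars_iff_constantCoeff, hφ', FaithfulSMul.algebraMap_eq_zero_iff] at h
    exact h
  have h3 : φ f = C (t ^ d) * MvPolynomial.map ι
      (aeval (fun i => X i + 1 : Fin 3 → MvPolynomial (Fin 3) K) f) := by
    have := hfh.eval₂_mul (C.comp ι) (C t : MvPolynomial (Fin 3) L) (fun i => X i + 1)
    rw [C_pow]
    refine this.trans ?_
    congr 1
    have e : (eval₂Hom (C.comp ι) fun i => X i + 1 :
        MvPolynomial (Fin 3) K →+* MvPolynomial (Fin 3) L) = (MvPolynomial.map ι).comp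
        (aeval (fun i => X i + 1 : Fin 3 → MvPolynomial (Fin 3) K)).toRingHom := by
      ext i : 2 <;> simp
    exact congrArg (fun ψ : MvPolynomial (Fin 3) K →+* MvPolynomial (Fin 3) L => ψ f) e
  apply mem_onesIdeal_pow_of_aeval
  rw [mem_pow_idealOfVars_iff'] at h2 ⊢
  intro x hx
  have h4 := h2 x hx
  rw [h3, coeff_C_mul, coeff_map] at h4
  have ht : t ^ d ≠ 0 := by
    apply pow_ne_zero
    simp [t]
  have h5 := (mul_eq_zero.mp h4).resolve_left ht
  exact (map_eq_zero ι).mp h5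

theorem LinearMap.finrank_range_le_of_ker_le {K V W₁ W₂ : Type*} [Field K]
    [AddCommGroup V] [Module K V] [AddCommGroup W₁] [Module K W₁] [AddCommGroup W₂] [Module K W₂]
    [FiniteDimensional K V] [FiniteDimensional K W₁] (φ : V →ₗ[K] W₁) (ψ : V →ₗ[K] W₂)
    (h : LinearMap.ker φ ≤ LinearMap.ker ψ) :
    Module.finrank K (LinearMap.range ψ) ≤ Module.finrank K W₁ := by
  have h1 := φ.finrank_range_add_finrank_ker
  have h2 := ψ.finrank_range_add_finrank_ker
  have h3 := Submodule.finrank_mono h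
  have h4 := Submodule.finrank_le (LinearMap.range φ)
  omega

theorem LinearMap.finrank_range_le_comp {K U V W : Type*} [Field K]
    [AddCommGroup U] [Module K U] [AddCommGroup V] [Module K V] [AddCommGroup W] [Module K W]
    [FiniteDimensional K U] [FiniteDimensional K V] (Λ : U →ₗ[K] V) (π : V →ₗ[K] W) :
    Module.finrank K (LinearMap.range Λ) ≤
      Module.finrank K (LinearMap.range (π ∘ₗ Λ)) + Module.finrank K (LinearMap.ker π) := by
  have h := (π.domRestrict (LinearMap.range Λ)).finrank_range_add_finrank_ker
  have h1 : LinearMap.range (π.domRestrict (LinearMap.range Λ)) = LinearMap.range (π ∘ₗ Λ) := by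
    rw [LinearMap.range_domRestrict, LinearMap.range_comp]
  have h2 : Module.finrank K (LinearMap.ker (π.domRestrict (LinearMap.range Λ))) ≤
      Module.finrank K (LinearMap.ker π) := by
    rw [← Submodule.finrank_map_subtype_eq]
    refine Submodule.finrank_mono ?_
    rintro _ ⟨x, hx, rfl⟩
    exact hx
  rw [← h1]
  omega

/-- The exponents of the monomials of total degree less than `k` in two variables. -/
abbrev LowExponents (k : ℕ) : Type := Σ i : Fin k, Fin (k - i)

theorem card_lowExponents_mul_two (k : ℕ) : Fintype.card (LowExponents k) * 2 = k * (k + 1) := by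
  have h : Fintype.card (LowExponents k) = ∑ i ∈ Finset.range k, (k - i) := by
    simp [Fintype.card_sigma, Finset.sum_range]
  rw [h]
  have h2 : ∑ i ∈ Finset.range k, (k - i) = ∑ i ∈ Finset.range (k + 1), i := by
    rw [Finset.sum_range_succ', ← Finset.sum_range_reflect]
    refine Finset.sum_congr rfl fun i hi => ?_
    have := Finset.mem_range.mp hi
    omega
  rw [h2, Finset.sum_range_id_mul_two]
  simp [mul_comm]

theorem card_lowExponents_add (r s : ℕ) : Fintype.card (LowExponents (r + s)) =
    Fintype.card (LowExponents r) + Fintype.card (LowExponents s) + r * s := by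
  have h1 := card_lowExponents_mul_two r
  have h2 := card_lowExponents_mul_two s
  have h3 := card_lowExponents_mul_two (r + s)
  nlinarith

section Truncation

variable {K : Type*} [Field K]

/-- The coefficients of the terms of total degree less than `k`. -/
noncomputable def truncCoeff (K : Type*) [Field K] (k : ℕ) :
    MvPolynomial (Fin 2) K →ₗ[K] (LowExponents k → K) :=
  LinearMap.pi fun m => lcoeff K (Finsupp.single 0 m.1.1 + Finsupp.single 1 m.2.1)

theorem ker_truncCoeff_iff {k : ℕ} {P : MvPolynomial (Fin 2) K} :
    truncCoeff K k P = 0 ↔ P ∈ idealOfVars (Fin 2) K ^ k := by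
  rw [mem_pow_idealOfVars_iff']
  constructor
  · intro h x hx
    rw [Finsupp.degree_eq_sum, Fin.sum_univ_two] at hx
    have := congrFun h ⟨⟨x 0, by omega⟩, ⟨x 1, by simp; omega⟩⟩
    simp only [truncCoeff, LinearMap.pi_apply, lcoeff_apply, Pi.zero_apply] at this
    rw [← this]
    congr 1
    ext i
    fin_cases i <;> simp
  · intro h
    ext ⟨i, j⟩
    simp only [truncCoeff, LinearMap.pi_apply, lcoeff_apply, Pi.zero_apply]
    apply h
    simp only [map_add, Finsupp.degree_single]
    omega

theorem truncCoeff_surjective (k : ℕ) : Function.Surjective (truncCoeff K k) := by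
  classical
  intro v
  refine ⟨∑ m : LowExponents k,
    monomial (Finsupp.single 0 m.1.1 + Finsupp.single 1 m.2.1) (v m), ?_⟩
  ext m
  rw [truncCoeff, LinearMap.pi_apply, lcoeff_apply, coeff_sum, Finset.sum_eq_single m]
  · simp
  · rintro ⟨i', j'⟩ - hne
    obtain ⟨i, j⟩ := m
    rw [coeff_monomial, if_neg]
    intro h
    apply hne
    have h0 := DFunLike.congr_fun h 0
    have h1 := DFunLike.congr_fun h 1
    simp at h0 h1
    obtain rfl : i' = i := Fin.ext h0
    obtain rfl : j' = j := Fin.ext h1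
    rfl
  · simp

end Truncation

theorem weight_wt (a b c : ℕ) (m : Fin 3 →₀ ℕ) :
    Finsupp.weight (wt a b c) m = m 0 * a + m 1 * b + m 2 * c := by
  rw [Finsupp.weight_apply, Finsupp.sum_fintype _ _ (by simp), Fin.sum_univ_three]
  simp [wt]

theorem wt_ne_zero {a b c : ℕ} (ha : 0 < a) (hb : 0 < b) (hc : 0 < c) (i : Fin 3) :
    wt a b c i ≠ 0 := by
  fin_cases i <;> simp [wt] <;> omega

/-- The exponents of the monomials of weighted degree `n`. -/
def exponentsOfWeight (a b c n : ℕ) : Set (Fin 3 →₀ ℕ) :=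
  {m | Finsupp.weight (wt a b c) m = n}

theorem exponentsOfWeight_finite {a b c : ℕ} (ha : 0 < a) (hb : 0 < b) (hc : 0 < c) (n : ℕ) :
    (exponentsOfWeight a b c n).Finite :=
  Finsupp.finite_of_nat_weight_eq _ (wt_ne_zero ha hb hc) n

theorem finrank_weightedHomogeneousSubmodule (K : Type*) [Field K] (a b c n : ℕ) :
    Module.finrank K (weightedHomogeneousSubmodule K (wt a b c) n) =
      (exponentsOfWeight a b c n).ncard := by
  rw [weightedHomogeneousSubmodule_eq_finsupp_supported]
  exact Module.finrank_eq_nat_card_basis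
    (basisRestrictSupport K (exponentsOfWeight a b c n))

theorem sep_exponentsOfWeight_eq_image {a b c n e : ℕ} (i : Fin 3) :
    {m ∈ exponentsOfWeight a b c (n + e * wt a b c i) | e ≤ m i} =
      (fun m => m + Finsupp.single i e) '' exponentsOfWeight a b c n := by
  ext m
  simp only [exponentsOfWeight, Set.mem_ofPred_eq, Set.mem_image]
  constructor
  · rintro ⟨h, hm⟩
    have hle : Finsupp.single i e ≤ m := by simpa using hm
    refine ⟨m - Finsupp.single i e, ?_, tsub_add_cancel_of_le hle⟩
    rw [← tsub_add_cancel_of_le hle, map_add, Finsupp.weight_single] at h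
    simpa using h
  · rintro ⟨x, hx, rfl⟩
    simp [hx, Finsupp.weight_single]

theorem box_ncard_le {a b c : ℕ} (hc : 0 < c) (hbc : Nat.Coprime b c) (d₀ d n : ℕ) :
    {m ∈ exponentsOfWeight a b c n | m 0 < d₀ ∧ m 1 < d * c}.ncard ≤ d₀ * d := by
  have hcard : ((Finset.range d₀ ×ˢ Finset.range d : Finset (ℕ × ℕ)) : Set (ℕ × ℕ)).ncard
      = d₀ * d := by
    rw [Set.ncard_coe_finset]; simp
  rw [← hcard]
  refine Set.ncard_le_ncard_of_injOn (fun m => (m 0, m 1 / c)) ?_ ?_ (Finset.finite_toSet _)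
  · rintro m ⟨-, h0, h1⟩
    simpa [h0] using Nat.div_lt_of_lt_mul (by linarith)
  · rintro m ⟨hm, -, -⟩ m' ⟨hm', -, -⟩ h
    simp only [exponentsOfWeight, Set.mem_ofPred_eq, weight_wt] at hm hm'
    simp only [Prod.mk.injEq] at h
    obtain ⟨h0, h1⟩ := h
    have hmod : b * m 1 ≡ b * m' 1 [MOD c] := by
      rw [← h0] at hm'
      have e : m 1 * b + m 2 * c = m' 1 * b + m' 2 * c := by omega
      have e1 : (b * m 1 + c * m 2) % c = (b * m' 1 + c * m' 2) % c := by
        congr 1; linarith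
      simpa [Nat.ModEq] using e1
    have h2 : m 1 % c = m' 1 % c := Nat.ModEq.cancel_left_of_coprime hbc.symm hmod
    have h3 : m 1 = m' 1 := by
      rw [← Nat.div_add_mod (m 1) c, ← Nat.div_add_mod (m' 1) c, h1, h2]
    have h4 : m 2 = m' 2 := by
      rw [← h0, ← h3] at hm'
      exact Nat.eq_of_mul_eq_mul_right hc (by omega)
    ext i
    fin_cases i <;> assumption

theorem ncard_exponentsOfWeight_add_le {a b c : ℕ} (ha : 0 < a) (hb : 0 < b) (hc : 0 < c)
    (hbc : Nat.Coprime b c) (d₀ d n : ℕ) :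
    (exponentsOfWeight a b c (n + d₀ * a + d * c * b)).ncard + (exponentsOfWeight a b c n).ncard ≤
      (exponentsOfWeight a b c (n + d * c * b)).ncard +
        (exponentsOfWeight a b c (n + d₀ * a)).ncard + d₀ * d := by
  set N := n + d₀ * a + d * c * b with hN
  have hinj (i : Fin 3) (e : ℕ) :
      Function.Injective fun m : Fin 3 →₀ ℕ => m + Finsupp.single i e :=
    add_left_injective _
  set A := {m ∈ exponentsOfWeight a b c N | d₀ ≤ m 0} with hA
  set B := {m ∈ exponentsOfWeight a b c N | d * c ≤ m 1} with hB
  have hAe : A = (fun m => m + Finsupp.single 0 d₀) '' exponentsOfWeight a b c (n + d * c * b) := by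
    rw [← sep_exponentsOfWeight_eq_image, hA]
    have : N = n + d * c * b + d₀ * wt a b c 0 := by simp only [hN, wt, Matrix.cons_val_zero]; ring
    rw [this]
  have hBe : B = (fun m => m + Finsupp.single 1 (d * c)) '' exponentsOfWeight a b c (n + d₀ * a) := by
    rw [← sep_exponentsOfWeight_eq_image, hB]
    rfl
  have hABe : A ∩ B = (fun m => m + Finsupp.single 1 (d * c)) ''
      ((fun m => m + Finsupp.single 0 d₀) '' exponentsOfWeight a b c n) := by
    have h0 : (fun m : Fin 3 →₀ ℕ => m + Finsupp.single 0 d₀) '' exponentsOfWeight a b c n =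
        {m ∈ exponentsOfWeight a b c (n + d₀ * a) | d₀ ≤ m 0} :=
      (sep_exponentsOfWeight_eq_image 0).symm
    rw [h0, hBe]
    ext m
    constructor
    · rintro ⟨hm, x, hx, rfl⟩
      exact ⟨x, ⟨hx, by simpa using hm.2⟩, rfl⟩
    · rintro ⟨x, ⟨hx, hx0⟩, rfl⟩
      have hm : x + Finsupp.single 1 (d * c) ∈ B := hBe ▸ ⟨x, hx, rfl⟩
      exact ⟨⟨hm.1, by simpa using hx0⟩, x, hx, rfl⟩
  have hfin := exponentsOfWeight_finite ha hb hc N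
  have h1 := Set.ncard_union_add_ncard_inter A B (hfin.subset (Set.sep_subset _ _))
    (hfin.subset (Set.sep_subset _ _))
  rw [hABe, hAe, hBe] at h1
  rw [Set.ncard_image_of_injective _ (hinj _ _), Set.ncard_image_of_injective _ (hinj _ _),
    Set.ncard_image_of_injective _ (hinj _ _), Set.ncard_image_of_injective _ (hinj _ _)] at h1
  have h2 : exponentsOfWeight a b c N ⊆
      (A ∪ B) ∪ {m ∈ exponentsOfWeight a b c N | m 0 < d₀ ∧ m 1 < d * c} := by
    intro m hm
    simp only [hA, hB, Set.mem_union, Set.mem_ofPred_eq, hm, true_and]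
    omega
  have h3 := Set.ncard_le_ncard h2 (((hfin.subset (Set.sep_subset _ _)).union
    (hfin.subset (Set.sep_subset _ _))).union (hfin.subset (Set.sep_subset _ _)))
  have h4 := Set.ncard_union_le (A ∪ B)
    {m ∈ exponentsOfWeight a b c N | m 0 < d₀ ∧ m 1 < d * c}
  have h5 := box_ncard_le (a := a) hc hbc d₀ d N
  rw [hAe, hBe] at h3 h4
  omega

/-- Restriction to the surface `x = (1 + u) ^ q`, `y = (1 + u) ^ p`, `z = 1 + v`, which is
transversal to the curve `(T ^ a, T ^ b, T ^ c)` at `(1, 1, 1)` when `q * b = p * a + 1`. -/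
noncomputable def slice (K : Type*) [Field K] (q p : ℕ) :
    MvPolynomial (Fin 3) K →ₐ[K] MvPolynomial (Fin 2) K :=
  aeval ![(1 + X 0) ^ q, (1 + X 0) ^ p, 1 + X 1]

theorem one_add_X_pow_sub_one_mem {K : Type*} [Field K] (i : Fin 2) (e : ℕ) :
    ((1 + X i) ^ e - 1 : MvPolynomial (Fin 2) K) ∈ idealOfVars (Fin 2) K := by
  rw [mem_idealOfVars_iff_constantCoeff]
  simp

theorem slice_mem_pow {K : Type*} [Field K] {q p n : ℕ} {f : MvPolynomial (Fin 3) K}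
    (hf : f ∈ onesIdeal K ^ n) : slice K q p f ∈ idealOfVars (Fin 2) K ^ n := by
  have h : (onesIdeal K).map (slice K q p) ≤ idealOfVars (Fin 2) K := by
    rw [onesIdeal, Ideal.map_span, Ideal.span_le]
    rintro _ ⟨_, ⟨i, rfl⟩, rfl⟩
    rw [SetLike.mem_coe, map_sub, map_one, slice, aeval_X]
    fin_cases i
    · exact one_add_X_pow_sub_one_mem _ _
    · exact one_add_X_pow_sub_one_mem _ _
    · simpa using one_add_X_pow_sub_one_mem (K := K) 1 1
  have h2 := Ideal.mem_map_of_mem (slice K q p) hf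
  rw [Ideal.map_pow] at h2
  exact Ideal.pow_right_mono h n h2

theorem exists_slice_eq_mul {K : Type*} [Field K] {a b c q p k N : ℕ} (hqp : q * b = p * a + 1)
    (hN : (a + c * q) * k ≤ N) {i j : ℕ} (hij : i + j ≤ k) :
    ∃ A : MvPolynomial (Fin 3) K, A.IsWeightedHomogeneous (wt a b c) (N * b) ∧
      ∃ e, slice K q p A = X 0 ^ i * X 1 ^ j * (1 + X 0) ^ e := by
  have hX (l : Fin 3) : (X l : MvPolynomial (Fin 3) K).IsWeightedHomogeneous (wt a b c)
    (wt a b c l) := isWeightedHomogeneous_X K (wt a b c) l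
  obtain ⟨M, hM⟩ : ∃ M, N = M + a * i + c * q * j := by
    refine ⟨N - a * i - c * q * j, ?_⟩
    have : a * i + c * q * j ≤ (a + c * q) * k := by
      nlinarith [Nat.zero_le (a * j), Nat.zero_le (c * q * i), Nat.mul_le_mul_left (a + c * q) hij]
    omega
  have h1 : (X 0 ^ b - X 1 ^ a : MvPolynomial (Fin 3) K).IsWeightedHomogeneous (wt a b c)
      (a * b) := by
    have e : b • wt a b c 0 = a * b := by simp [wt, mul_comm]
    exact IsWeightedHomogeneous.sub (e ▸ (hX 0).pow b) ((hX 1).pow a)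
  have h2 : (X 0 ^ (c * p) * X 2 - X 1 ^ (c * q) : MvPolynomial (Fin 3) K).IsWeightedHomogeneous
      (wt a b c) (c * q * b) := by
    have e : (c * p) • wt a b c 0 + wt a b c 2 = c * q * b := by
      simp only [wt, smul_eq_mul, Matrix.cons_val]
      rw [mul_assoc c q b, hqp]; ring
    exact IsWeightedHomogeneous.sub (e ▸ ((hX 0).pow (c * p)).mul (hX 2)) ((hX 1).pow (c * q))
  refine ⟨(X 0 ^ b - X 1 ^ a) ^ i * (X 0 ^ (c * p) * X 2 - X 1 ^ (c * q)) ^ j * X 1 ^ M, ?_,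
    p * a * i + p * q * c * j + p * M, ?_⟩
  · convert ((h1.pow i).mul (h2.pow j)).mul ((hX 1).pow M) using 1
    simp only [wt, smul_eq_mul, Matrix.cons_val]
    rw [hM]; ring
  · have s0 : slice K q p (X 0) = (1 + X 0) ^ q := by simp [slice]
    have s1 : slice K q p (X 1) = (1 + X 0) ^ p := by simp [slice]
    have s2 : slice K q p (X 2) = 1 + X 1 := by simp [slice]
    have e1 : slice K q p (X 0 ^ b - X 1 ^ a) = (1 + X 0) ^ (p * a) * X 0 := by
      rw [map_sub, map_pow, map_pow, s0, s1, ← pow_mul, hqp, ← pow_mul]; ring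
    have e2 : slice K q p (X 0 ^ (c * p) * X 2 - X 1 ^ (c * q)) =
        (1 + X 0) ^ (p * q * c) * X 1 := by
      rw [map_sub, map_mul, map_pow, map_pow, s0, s1, s2, ← pow_mul, ← pow_mul,
        show q * (c * p) = p * q * c by ring, show p * (c * q) = p * q * c by ring]
      ring
    rw [map_mul, map_mul, map_pow, map_pow, map_pow, e1, e2, s1]
    ring

theorem exists_slice_sub_mem_pow {K : Type*} [Field K] {a b c q p k N : ℕ}
    (hqp : q * b = p * a + 1) (hN : (a + c * q) * k ≤ N) (P : MvPolynomial (Fin 2) K) :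
    ∃ A : MvPolynomial (Fin 3) K, A.IsWeightedHomogeneous (wt a b c) (N * b) ∧
      slice K q p A - P ∈ idealOfVars (Fin 2) K ^ k := by
  let W : Submodule K (MvPolynomial (Fin 2) K) :=
    (weightedHomogeneousSubmodule K (wt a b c) (N * b)).map (slice K q p).toLinearMap ⊔
      (idealOfVars (Fin 2) K ^ k).restrictScalars K
  have hsum (D : ℕ) (h : ∀ (m : Fin 2 →₀ ℕ) (r : K), D ≤ m.degree → monomial m r ∈ W)
      (Q : MvPolynomial (Fin 2) K) (hQ : Q ∈ idealOfVars (Fin 2) K ^ D) : Q ∈ W := by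
    rw [← support_sum_monomial_coeff Q]
    exact Submodule.sum_mem _ fun m hm => h m _ ((mem_pow_idealOfVars_iff D Q).mp hQ m hm)
  have hmon (t : ℕ) : ∀ (m : Fin 2 →₀ ℕ) (r : K), k - t ≤ m.degree → monomial m r ∈ W := by
    induction t with
    | zero =>
      intro m r hm
      refine Submodule.mem_sup_right ?_
      by_cases hr : r = 0
      · simp [hr]
      · exact (monomial_mem_pow_idealOfVars_iff k m hr).mpr (by simpa using hm)
    | succ t ih =>
      intro m r hm
      by_cases hk : k ≤ m.degree
      · exact ih m r (by omega)
      have hdeg : m.degree = m 0 + m 1 := by rw [Finsupp.degree_eq_sum, Fin.sum_univ_two]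
      obtain ⟨A, hA, e, he⟩ := exists_slice_eq_mul (K := K) (i := m 0) (j := m 1) hqp hN
        (by omega)
      have hmono : monomial m r = C r * (X 0 ^ m 0 * X 1 ^ m 1) := by
        rw [monomial_eq, Finsupp.prod_fintype _ _ (by simp), Fin.prod_univ_two]
      have hrem : monomial m r * ((1 + X 0) ^ e - 1) ∈ W := by
        refine hsum (m.degree + 1) (fun m' r' hm' => ih m' r' (by omega)) _ ?_
        rw [pow_succ]
        refine Ideal.mul_mem_mul ?_ (one_add_X_pow_sub_one_mem 0 e)
        by_cases hr : r = 0
        · simp [hr]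
        · exact (monomial_mem_pow_idealOfVars_iff _ m hr).mpr le_rfl
      have hmain : slice K q p (C r * A) ∈ W :=
        Submodule.mem_sup_left ⟨C r * A, hA.C_mul r, rfl⟩
      have : monomial m r = slice K q p (C r * A) - monomial m r * ((1 + X 0) ^ e - 1) := by
        rw [map_mul, he, hmono]
        have : slice K q p (C r) = C r := by simp [slice]
        rw [this]; ring
      rw [this]
      exact sub_mem hmain hrem
  have hP : P ∈ W := hsum 0 (fun m r _ => hmon k m r (by omega)) P (by simp)
  obtain ⟨_, ⟨A, hA, rfl⟩, y, hy, hxy⟩ := Submodule.mem_sup.mp hP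
  refine ⟨A, hA, ?_⟩
  rw [← hxy]
  simpa using hy

theorem exists_mul_eq_mul_add_one {a b : ℕ} (ha : 0 < a) (hb : 0 < b) (hab : Nat.Coprime a b) :
    ∃ q p, q * b = p * a + 1 := by
  rcases Nat.lt_or_ge 1 a with h | h
  · obtain ⟨q, hq⟩ := Nat.exists_mul_mod_eq_one_of_coprime hab.symm h
    refine ⟨q, b * q / a, ?_⟩
    have := Nat.div_add_mod (b * q) a
    rw [hq.2] at this
    linarith
  · obtain rfl : a = 1 := by omega
    exact ⟨1, b - 1, by omega⟩

theorem multiplicity_mul_le_of_isRelPrime {K : Type*} [Field K] {a b c : ℕ}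
    (ha : 0 < a) (hb : 0 < b) (hc : 0 < c) (hab : Nat.Coprime a b) (hbc : Nat.Coprime b c)
    {F G : MvPolynomial (Fin 3) K} {d₀ d r s : ℕ} (hFG : IsRelPrime F G) (hG : G ≠ 0)
    (hFh : F.IsWeightedHomogeneous (wt a b c) (d₀ * a))
    (hGh : G.IsWeightedHomogeneous (wt a b c) (d * c * b))
    (hFr : F ∈ onesIdeal K ^ r) (hGs : G ∈ onesIdeal K ^ s) : r * s ≤ d₀ * d := by
  obtain ⟨q, p, hqp⟩ := exists_mul_eq_mul_add_one ha hb hab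
  set N := (a + c * q) * (r + s) + d₀ * a + d * c with hN
  obtain ⟨n, hn⟩ : ∃ n, N * b = n + d₀ * a + d * c * b := by
    refine ⟨N * b - d₀ * a - d * c * b, ?_⟩
    have : d₀ * a + d * c * b ≤ N * b := by
      rw [hN]
      nlinarith [Nat.zero_le ((a + c * q) * (r + s) * b), Nat.le_mul_of_pos_right (d₀ * a) hb]
    omega
  let V (m : ℕ) := weightedHomogeneousSubmodule K (wt a b c) m
  have hfin (m : ℕ) : FiniteDimensional K (V m) :=
    Module.Finite.iff_fg.mpr (weightedHomogeneousSubmodule_fg K _ (wt_ne_zero ha hb hc) m)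
  have hV (m : ℕ) : Module.finrank K (V m) = (exponentsOfWeight a b c m).ncard :=
    finrank_weightedHomogeneousSubmodule K a b c m
  let ev (k m : ℕ) : V m →ₗ[K] (LowExponents k → K) :=
    truncCoeff K k ∘ₗ (slice K q p).toLinearMap ∘ₗ (V m).subtype
  have hev (k m : ℕ) (x : V m) : ev k m x = 0 ↔
      slice K q p x ∈ idealOfVars (Fin 2) K ^ k := ker_truncCoeff_iff
  let Λ : (V (n + d * c * b) × V (n + d₀ * a)) →ₗ[K] V (N * b) :=
    LinearMap.codRestrict (V (N * b))
      ((LinearMap.mulRight K F ∘ₗ (V (n + d * c * b)).subtype).coprod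
        (LinearMap.mulRight K G ∘ₗ (V (n + d₀ * a)).subtype)) (by
      rintro ⟨⟨x, hx⟩, ⟨y, hy⟩⟩
      refine add_mem (show IsWeightedHomogeneous _ (x * F) _ from ?_)
        (show IsWeightedHomogeneous _ (y * G) _ from ?_)
      · rw [hn]; convert IsWeightedHomogeneous.mul hx hFh using 1; ring
      · rw [hn]; exact IsWeightedHomogeneous.mul hy hGh)
  have hΛ (x) : (Λ x : MvPolynomial (Fin 3) K) = x.1 * F + x.2 * G := rfl
  have hker : Module.finrank K (LinearMap.ker Λ) ≤ Module.finrank K (V n) := by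
    let ρ : LinearMap.ker Λ →ₗ[K] (V n).map (LinearMap.mulRight K G) :=
      LinearMap.codRestrict _ ((V (n + d * c * b)).subtype ∘ₗ LinearMap.fst K _ _ ∘ₗ
        (LinearMap.ker Λ).subtype) (by
      rintro ⟨⟨⟨x, hx⟩, ⟨y, hy⟩⟩, hxy⟩
      have h0 : x * F + y * G = 0 := congrArg Subtype.val hxy
      show x ∈ _
      have hdvd : G ∣ x := by
        refine IsRelPrime.dvd_of_dvd_mul_right hFG.symm (Dvd.intro_left (-y) ?_)
        linear_combination -h0
      obtain ⟨z, rfl⟩ := hdvd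
      by_cases hz : z = 0
      · simp [hz]
      obtain ⟨j, hj, hzj⟩ := hGh.exists_of_mul hx hG hz
      refine ⟨z, ?_, mul_comm _ _⟩
      obtain rfl : j = n := by omega
      exact hzj)
    have hρ : Function.Injective ρ := by
      rintro ⟨⟨⟨x, hx⟩, ⟨y, hy⟩⟩, hxy⟩ ⟨⟨⟨x', hx'⟩, ⟨y', hy'⟩⟩, hxy'⟩ h
      have h0 : x * F + y * G = 0 := congrArg Subtype.val hxy
      have h0' : x' * F + y' * G = 0 := congrArg Subtype.val hxy'
      obtain rfl : x = x' := congrArg Subtype.val h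
      obtain rfl : y = y' := mul_right_cancel₀ hG (by linear_combination h0 - h0')
      rfl
    exact (LinearMap.finrank_le_finrank_of_injective hρ).trans (Submodule.finrank_map_le _ _)
  have hsurj : Module.finrank K (LinearMap.range (ev (r + s) (N * b))) =
      Fintype.card (LowExponents (r + s)) := by
    rw [LinearMap.range_eq_top.mpr, finrank_top, Module.finrank_fintype_fun_eq_card]
    intro v
    obtain ⟨P, rfl⟩ := truncCoeff_surjective _ v
    obtain ⟨A, hA, hAP⟩ := exists_slice_sub_mem_pow (K := K) (c := c) (N := N) (k := r + s) hqp
      (by omega) P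
    refine ⟨⟨A, hA⟩, ?_⟩
    rw [← sub_eq_zero, ← ker_truncCoeff_iff.mpr hAP, map_sub]
    rfl
  have hcomp : Module.finrank K (LinearMap.range (ev (r + s) (N * b) ∘ₗ Λ)) ≤
      Fintype.card (LowExponents s) + Fintype.card (LowExponents r) := by
    have h := LinearMap.finrank_range_le_of_ker_le
      ((ev s (n + d * c * b)).prodMap (ev r (n + d₀ * a))) (ev (r + s) (N * b) ∘ₗ Λ) ?_
    · simpa using h
    · intro x hx
      rw [LinearMap.mem_ker, LinearMap.prodMap_apply, Prod.mk_eq_zero, hev, hev] at hx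
      rw [LinearMap.mem_ker, LinearMap.comp_apply, hev, hΛ, map_add, map_mul, map_mul]
      refine add_mem ?_ ?_
      · rw [add_comm, pow_add]; exact Ideal.mul_mem_mul hx.1 (slice_mem_pow hFr)
      · rw [pow_add]; exact Ideal.mul_mem_mul hx.2 (slice_mem_pow hGs)
  have h1 := Λ.finrank_range_add_finrank_ker
  have h2 := Λ.finrank_range_le_comp (ev (r + s) (N * b))
  have h3 := (ev (r + s) (N * b)).finrank_range_add_finrank_ker
  have h4 := ncard_exponentsOfWeight_add_le ha hb hc hbc d₀ d n
  have h5 := card_lowExponents_add r s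
  rw [Module.finrank_prod] at h1
  rw [← hn] at h4
  simp only [hV] at h1 h2 h3 hker
  omega

theorem aeval_X_add_one_mem_pow {K : Type*} [CommRing K] {f : MvPolynomial (Fin 3) K} {n : ℕ}
    (hf : f ∈ onesIdeal K ^ n) :
    aeval (fun i => X i + 1 : Fin 3 → MvPolynomial (Fin 3) K) f ∈ idealOfVars (Fin 3) K ^ n := by
  let ψ : MvPolynomial (Fin 3) K →ₐ[K] MvPolynomial (Fin 3) K := aeval fun i => X i + 1
  have h : (onesIdeal K).map ψ ≤ idealOfVars (Fin 3) K := by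
    rw [onesIdeal, Ideal.map_span, Ideal.span_le]
    rintro _ ⟨_, ⟨i, rfl⟩, rfl⟩
    exact Ideal.subset_span ⟨i, by simp [ψ]⟩
  have h2 := Ideal.mem_map_of_mem ψ hf
  rw [Ideal.map_pow] at h2
  exact Ideal.pow_right_mono h n h2

theorem mem_pow_idealOfVars_iff_le_order {σ K : Type*} [CommRing K] {f : MvPolynomial σ K}
    {n : ℕ} : f ∈ idealOfVars σ K ^ n ↔ (n : ℕ∞) ≤ (f : MvPowerSeries σ K).order := by
  rw [mem_pow_idealOfVars_iff']
  constructor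
  · intro h
    refine MvPowerSeries.le_order fun m hm => ?_
    rw [coeff_coe]
    exact h m (by exact_mod_cast hm)
  · intro h m hm
    rw [← coeff_coe]
    exact MvPowerSeries.coeff_of_lt_order (lt_of_lt_of_le (by exact_mod_cast hm) h)

theorem mem_onesIdeal_pow_of_mul_mem {K : Type*} [Field K] {f g : MvPolynomial (Fin 3) K}
    {r s : ℕ} (hf : f ∉ onesIdeal K ^ (r + 1)) (hfg : f * g ∈ onesIdeal K ^ (r + s)) :
    g ∈ onesIdeal K ^ s := by
  have h := aeval_X_add_one_mem_pow hfg
  have hf' := mt mem_onesIdeal_pow_of_aeval hf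
  apply mem_onesIdeal_pow_of_aeval
  rw [mem_pow_idealOfVars_iff_le_order] at h hf' ⊢
  rw [map_mul, coe_mul, MvPowerSeries.order_mul] at h
  rw [not_le] at hf'
  generalize (aeval (fun i => X i + 1 : Fin 3 → MvPolynomial (Fin 3) K) f :
    MvPowerSeries (Fin 3) K).order = x at h hf'
  generalize (aeval (fun i => X i + 1 : Fin 3 → MvPolynomial (Fin 3) K) g :
    MvPowerSeries (Fin 3) K).order = y at h ⊢
  induction x using ENat.recTopCoe with
  | top => simp at hf'
  | coe x =>
    induction y using ENat.recTopCoe with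
    | top => simp
    | coe y =>
      norm_cast at *
      omega

theorem mul_multiplicity_le_of_not_dvd {K : Type*} [Field K] {a b c : ℕ}
    (ha : 0 < a) (hb : 0 < b) (hc : 0 < c) (hab : Nat.Coprime a b) (hbc : Nat.Coprime b c)
    {f g : MvPolynomial (Fin 3) K} {d₀ d r s : ℕ} (hf : Irreducible f) (hfg : ¬ f ∣ g)
    (hfh : f.IsWeightedHomogeneous (wt a b c) d₀) (hgh : g.IsWeightedHomogeneous (wt a b c) d)
    (hfr : f ∈ onesIdeal K ^ r) (hgs : g ∈ onesIdeal K ^ s) :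
    a * b * c * (r * s) ≤ d₀ * d := by
  have hg : g ≠ 0 := by
    rintro rfl
    exact hfg (dvd_zero f)
  have hrel : IsRelPrime (f ^ a) (g ^ (b * c)) :=
    ((hf.isRelPrime_iff_not_dvd).mpr hfg).pow
  have e1 : a • d₀ = d₀ * a := by rw [smul_eq_mul, mul_comm]
  have e2 : (b * c) • d = d * c * b := by rw [smul_eq_mul]; ring
  have h := multiplicity_mul_le_of_isRelPrime (r := r * a) (s := s * (b * c)) ha hb hc hab hbc
    hrel (pow_ne_zero _ hg) (e1 ▸ hfh.pow a) (e2 ▸ hgh.pow (b * c))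
    (by rw [pow_mul]; exact Ideal.pow_mem_pow hfr a)
    (by rw [pow_mul]; exact Ideal.pow_mem_pow hgs _)
  linarith

theorem exists_expand_eq {σ K : Type*} [CommRing K] {p : ℕ} {f : MvPolynomial σ K}
    (h : ∀ m ∈ f.support, ∀ i, p ∣ m i) : ∃ g, expand p g = f := by
  refine ⟨∑ m ∈ f.support, monomial (m.mapRange (· / p) (Nat.zero_div p)) (coeff m f), ?_⟩
  conv_rhs => rw [← support_sum_monomial_coeff f]
  rw [map_sum]
  refine Finset.sum_congr rfl fun m hm => ?_
  rw [expand_monomial]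
  have : p • m.mapRange (· / p) (Nat.zero_div p) = m := by
    ext i
    simp [Nat.mul_div_cancel' (h m hm i)]
  rw [this]

theorem cast_eq_zero_of_pderiv_eq_zero {σ K : Type*} [Field K] {f : MvPolynomial σ K}
    {i : σ} (hi : pderiv i f = 0) {m : σ →₀ ℕ} (hm : m ∈ f.support) : (m i : K) = 0 := by
  classical
  by_cases h0 : m i = 0
  · simp [h0]
  obtain ⟨m', rfl⟩ : ∃ m', m = m' + Finsupp.single i 1 :=
    ⟨m - Finsupp.single i 1, (tsub_add_cancel_of_le (by
      rw [Finsupp.single_le_iff]; omega)).symm⟩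
  have h := coeff_pderiv (i := i) f m'
  rw [hi, coeff_zero] at h
  have := (mul_eq_zero.mp h.symm).resolve_left (mem_support_iff.mp hm)
  simpa using this

theorem not_mem_onesIdeal_pow_succ {K : Type*} [Field K] {a b c : ℕ}
    (ha : 0 < a) (hb : 0 < b) (hc : 0 < c) (hab : Nat.Coprime a b) (hbc : Nat.Coprime b c)
    {f : MvPolynomial (Fin 3) K} {d₀ r : ℕ} (hf : Irreducible f)
    (hfh : f.IsWeightedHomogeneous (wt a b c) d₀) (hd : d₀ ^ 2 < a * b * c * r ^ 2) :
    f ∉ onesIdeal K ^ (r + 1) := by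
  intro hmem
  have hfr : f ∈ onesIdeal K ^ r := Ideal.pow_le_pow_right (Nat.le_succ r) hmem
  have hpd (i : Fin 3) : pderiv i f = 0 := by
    by_contra hne
    have hwi : 0 < wt a b c i := by fin_cases i <;> simpa [wt]
    by_cases hle : wt a b c i ≤ d₀
    · have hh : (pderiv i f).IsWeightedHomogeneous (wt a b c) (d₀ - wt a b c i) :=
        hfh.pderiv (by omega)
      have hndvd : ¬ f ∣ pderiv i f := by
        rintro ⟨g, hg⟩
        have hg0 : g ≠ 0 := by
          rintro rfl
          simp [hg] at hne
        obtain ⟨j, hj, -⟩ := hfh.exists_of_mul (hg ▸ hh) hf.ne_zero hg0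
        omega
      have := mul_multiplicity_le_of_not_dvd ha hb hc hab hbc hf hndvd hfh hh hfr
        (derivation_mem_pow (pderiv i) _ r hmem)
      nlinarith [Nat.mul_le_mul_left d₀ (Nat.sub_le d₀ (wt a b c i))]
    · obtain ⟨m, hm⟩ := ne_zero_iff.mp hne
      rw [coeff_pderiv] at hm
      have := hfh (left_ne_zero_of_mul hm)
      rw [map_add, Finsupp.weight_single] at this
      simp at this
      omega
  have hcast (m) (hm : m ∈ f.support) (i : Fin 3) : (m i : K) = 0 :=
    cast_eq_zero_of_pderiv_eq_zero (hpd i) hm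
  have hdeg : f.totalDegree ≠ 0 := by
    intro h0
    rw [totalDegree_eq_zero_iff_eq_C] at h0
    refine hf.not_isUnit ?_
    rw [h0]
    refine IsUnit.map C (IsUnit.mk0 _ fun h => hf.ne_zero ?_)
    rw [h0, h, C_0]
  obtain ⟨p, hp⟩ := CharP.exists K
  rcases CharP.char_is_prime_or_zero K p with hpp | rfl
  · have := Fact.mk hpp
    have := ExpChar.prime (R := K) hpp
    obtain ⟨h, rfl⟩ := exists_expand_eq fun m hm i =>
      (CharP.cast_eq_zero_iff K p _).mp (hcast m hm i)
    have hpow : (expand p h).map (frobenius K p) = h ^ p := map_frobenius_expand p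
    have hhr : h ^ p ∈ onesIdeal K ^ r := hpow ▸ map_mem_onesIdeal_pow _ hfr
    have hhh : (h ^ p).IsWeightedHomogeneous (wt a b c) d₀ := by
      rw [← hpow]
      intro m hm
      rw [coeff_map] at hm
      exact hfh fun h0 => hm (by rw [h0, map_zero])
    have hdvd : expand p h ∣ h ^ p := by
      by_contra hndvd
      have := mul_multiplicity_le_of_not_dvd ha hb hc hab hbc hf hndvd hfh hhh hfr hhr
      nlinarith
    obtain ⟨g, hg⟩ := hf.prime.dvd_of_dvd_pow hdvd
    have hg0 : expand p h * g ≠ 0 := by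
      rw [← hg]
      rintro rfl
      simp at hdeg
    have h1 := congrArg totalDegree hg
    rw [totalDegree_mul_of_isDomain (left_ne_zero_of_mul hg0) (right_ne_zero_of_mul hg0)] at h1
    rw [totalDegree_expand] at h1 hdeg
    have := hpp.two_le
    nlinarith [Nat.pos_of_ne_zero (left_ne_zero_of_mul hdeg)]
  · have := CharP.charP_to_charZero K
    refine hdeg ((totalDegree_eq_zero_iff _ _).mpr fun m hm i => ?_)
    exact_mod_cast hcast m hm i

theorem eq_zero_of_mem_onesIdeal_pow {K : Type*} [Field K] {a b c : ℕ}
    (ha : 0 < a) (hb : 0 < b) (hc : 0 < c) (hab : Nat.Coprime a b) (hbc : Nat.Coprime b c)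
    {f : MvPolynomial (Fin 3) K} {r₀ d₀ : ℕ} (hd₀ : 0 < d₀) (hf : Irreducible f)
    (hfr : f ∈ onesIdeal K ^ r₀) (hfh : f.IsWeightedHomogeneous (wt a b c) d₀)
    (hneg : d₀ ^ 2 < a * b * c * r₀ ^ 2) {g : MvPolynomial (Fin 3) K} {r d : ℕ}
    (hlt : d * r₀ < d₀ * r) (hgr : g ∈ onesIdeal K ^ r)
    (hgh : g.IsWeightedHomogeneous (wt a b c) d) : g = 0 := by
  induction d using Nat.strong_induction_on generalizing g r with
  | _ d ih =>
    by_contra hg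
    have hdvd : f ∣ g := by
      by_contra hndvd
      have h1 := mul_multiplicity_le_of_not_dvd ha hb hc hab hbc hf hndvd hfh hgh hfr hgr
      have hr : 0 < r := Nat.pos_of_ne_zero (by rintro rfl; simp at hlt)
      have h2 : d₀ * (d * r₀) < d₀ * (d₀ * r) := Nat.mul_lt_mul_of_pos_left hlt hd₀
      have h3 : d₀ ^ 2 * r < a * b * c * r₀ ^ 2 * r := Nat.mul_lt_mul_of_pos_right hneg hr
      have h4 : a * b * c * (r₀ * r) * r₀ ≤ d₀ * d * r₀ := Nat.mul_le_mul_right _ h1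
      linarith
    obtain ⟨h, rfl⟩ := hdvd
    obtain ⟨j, hj, hhh⟩ := hfh.exists_of_mul hgh hf.ne_zero (right_ne_zero_of_mul hg)
    have hr : r₀ ≤ r := by
      by_contra! hr
      have : d₀ * r₀ ≤ d * r₀ := Nat.mul_le_mul_right _ (by omega)
      have : d₀ * r ≤ d₀ * r₀ := Nat.mul_le_mul_left _ hr.le
      omega
    obtain ⟨s, rfl⟩ := Nat.exists_eq_add_of_le hr
    refine right_ne_zero_of_mul hg (ih j (by omega) ?_ (mem_onesIdeal_pow_of_mul_mem
      (not_mem_onesIdeal_pow_succ ha hb hc hab hbc hf hfh hneg) hgr) hhh)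
    subst hj
    linarith

/-- if a negative curve lies in `[𝔭^{(r0)}]_{d0}`, then
`[𝔭^{(r)}]_d = 0` whenever `r > 0`, `d ≥ 0` and `d/r < d0/r0`
(i.e. `d·r0 < d0·r`). -/
theorem statement9 (K : Type*) [Field K] (a b c : ℕ)
    (ha : 0 < a) (hb : 0 < b) (hc : 0 < c)
    (hab : Nat.Coprime a b) (hbc : Nat.Coprime b c) (hca : Nat.Coprime c a)
    (f : MvPolynomial (Fin 3) K) (r0 d0 : ℕ) (hr0 : 0 < r0) (hd0 : 0 < d0)
    (hirr : Irreducible f)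
    (hf : f ∈ symbPow (pIdeal K a b c) r0)
    (hfh : f.IsWeightedHomogeneous (wt a b c) d0)
    (hneg : d0 ^ 2 < a * b * c * r0 ^ 2)
    (r d : ℕ) (hr : 0 < r) (hlt : d * r0 < d0 * r) :
    gpiece K a b c (symbPow (pIdeal K a b c) r) d = ⊥ := by
  rw [eq_bot_iff]
  rintro g ⟨hg, hgh⟩
  exact eq_zero_of_mem_onesIdeal_pow ha hb hc hab hbc hd0 hirr
    (mem_onesIdeal_pow_of_mem_symbPow hf hfh) hfh hneg hlt
    (mem_onesIdeal_pow_of_mem_symbPow hg hgh) hgh
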